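/- Fix N ≥ 1, p_A = 1/2, and game-B parameters {p1, p2, p3} = {p1, 1/2, 1-p1} with p1 ∈ (0,1). Then for every mixing probability γ ∈ [0,1], the stochastic combination A+B is a fair game: p_win^{A+B} = 1/2, i.e. the current J^{A+B} = 2·p_win^{A+B} - 1 vanishes, independently of γ, N, and p1. -/

import Mathlib

open Finset

/-- Winning probability of game B at state `i` for parameters `p1, p2, p3`,
with `round x` the nearest integer to `x`. -/
noncomputable def gameB (N : ℕ) (p1 p2 p3 : ℝ) (i : ℕ) : ℝ :=
  if round ((2 * N : ℝ) / 3) < (i : ℤ) then p1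
  else if round ((N : ℝ) / 3) ≤ (i : ℤ) then p2
  else p3

/-- `a i = γ·pA + (1-γ)·p^B_i`. -/
noncomputable def aProb (N : ℕ) (pA p1 p2 p3 γ : ℝ) (i : ℕ) : ℝ :=
  γ * pA + (1 - γ) * gameB N p1 p2 p3 i

/-- Forward transition probability `p_i = ((N-i)/N)·a_i`. -/
noncomputable def fwd (N : ℕ) (pA p1 p2 p3 γ : ℝ) (i : ℕ) : ℝ :=
  (((N : ℝ) - (i : ℝ)) / (N : ℝ)) * aProb N pA p1 p2 p3 γ i

/-- Backward transition probability `q_i = (i/N)·(1-a_i)`. -/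
noncomputable def bwd (N : ℕ) (pA p1 p2 p3 γ : ℝ) (i : ℕ) : ℝ :=
  ((i : ℝ) / (N : ℝ)) * (1 - aProb N pA p1 p2 p3 γ i)

/-- Staying probability `r_i = 1 - p_i - q_i`. -/
noncomputable def stay (N : ℕ) (pA p1 p2 p3 γ : ℝ) (i : ℕ) : ℝ :=
  1 - fwd N pA p1 p2 p3 γ i - bwd N pA p1 p2 p3 γ i

/-- Unnormalized stationary weight `Π_i = (∏_{j=0}^{i-1} p_j)·(∏_{j=i+1}^{N} q_j)`. -/
noncomputable def wt (N : ℕ) (pA p1 p2 p3 γ : ℝ) (i : ℕ) : ℝ :=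
  (∏ j ∈ Finset.range i, fwd N pA p1 p2 p3 γ j) *
    (∏ j ∈ Finset.Icc (i + 1) N, bwd N pA p1 p2 p3 γ j)

/-- Normalization `Z = Σ_{i=0}^{N} Π_i`. -/
noncomputable def Znorm (N : ℕ) (pA p1 p2 p3 γ : ℝ) : ℝ :=
  ∑ i ∈ Finset.range (N + 1), wt N pA p1 p2 p3 γ i

/-- Stationary probability `P^st_i = Π_i / Z`. -/
noncomputable def Pst (N : ℕ) (pA p1 p2 p3 γ : ℝ) (i : ℕ) : ℝ :=
  wt N pA p1 p2 p3 γ i / Znorm N pA p1 p2 p3 γ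

/-- Average winning probability `p_win = Σ_{i=0}^{N} a_i · P^st_i`. -/
noncomputable def pwin (N : ℕ) (pA p1 p2 p3 γ : ℝ) : ℝ :=
  ∑ i ∈ Finset.range (N + 1), aProb N pA p1 p2 p3 γ i * Pst N pA p1 p2 p3 γ i

/-- Current `J = 2·p_win - 1`. -/
noncomputable def current (N : ℕ) (pA p1 p2 p3 γ : ℝ) : ℝ :=
  2 * pwin N pA p1 p2 p3 γ - 1

/-- The two thresholds of game B are mirror images of each other under `i ↦ N - i`. -/
theorem round_third_add_round_two_thirds (N : ℕ) :
    round ((N : ℝ) / 3) + round ((2 * N : ℝ) / 3) = (N : ℤ) := by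
  rw [round_eq, round_eq]
  set m := ⌊(N : ℝ) / 3 + 1 / 2⌋ with hm
  set n := ⌊(2 * N : ℝ) / 3 + 1 / 2⌋ with hn
  obtain ⟨hm1, hm2⟩ := Int.floor_eq_iff.1 hm.symm
  obtain ⟨hn1, hn2⟩ := Int.floor_eq_iff.1 hn.symm
  have h1 : 6 * m ≤ 2 * (N : ℤ) + 3 := by
    have : (6 * m : ℝ) ≤ 2 * N + 3 := by linarith
    exact_mod_cast this
  have h2 : 2 * (N : ℤ) + 3 < 6 * m + 6 := by
    have : (2 * N + 3 : ℝ) < 6 * m + 6 := by linarith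
    exact_mod_cast this
  have h3 : 6 * n ≤ 4 * (N : ℤ) + 3 := by
    have : (6 * n : ℝ) ≤ 4 * N + 3 := by linarith
    exact_mod_cast this
  have h4 : 4 * (N : ℤ) + 3 < 6 * n + 6 := by
    have : (4 * N + 3 : ℝ) < 6 * n + 6 := by linarith
    exact_mod_cast this
  omega

theorem round_third_le_round_two_thirds (N : ℕ) :
    round ((N : ℝ) / 3) ≤ round ((2 * N : ℝ) / 3) := by
  rw [round_eq, round_eq]
  have hN : (0 : ℝ) ≤ N := N.cast_nonneg
  exact Int.floor_le_floor (by linarith)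

theorem gameB_reflect {N i : ℕ} (hi : i ≤ N) (p1 : ℝ) :
    gameB N p1 (1 / 2) (1 - p1) (N - i) = 1 - gameB N p1 (1 / 2) (1 - p1) i := by
  have hsum := round_third_add_round_two_thirds N
  have hle := round_third_le_round_two_thirds N
  unfold gameB
  split_ifs <;> first | omega | ring

theorem aProb_reflect {N i : ℕ} (hi : i ≤ N) (p1 γ : ℝ) :
    aProb N (1 / 2) p1 (1 / 2) (1 - p1) γ (N - i) =
      1 - aProb N (1 / 2) p1 (1 / 2) (1 - p1) γ i := by
  unfold aProb
  rw [gameB_reflect hi]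
  ring

theorem fwd_reflect {N i : ℕ} (hi : i ≤ N) (p1 γ : ℝ) :
    fwd N (1 / 2) p1 (1 / 2) (1 - p1) γ (N - i) =
      bwd N (1 / 2) p1 (1 / 2) (1 - p1) γ i := by
  unfold fwd bwd
  rw [aProb_reflect hi, Nat.cast_sub hi, sub_sub_cancel]

theorem bwd_reflect {N i : ℕ} (hi : i ≤ N) (p1 γ : ℝ) :
    bwd N (1 / 2) p1 (1 / 2) (1 - p1) γ (N - i) =
      fwd N (1 / 2) p1 (1 / 2) (1 - p1) γ i := by
  rw [← fwd_reflect (Nat.sub_le N i), Nat.sub_sub_self hi]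

theorem prod_range_fwd_eq {N i : ℕ} (hi : i ≤ N) (p1 γ : ℝ) :
    ∏ j ∈ range i, fwd N (1 / 2) p1 (1 / 2) (1 - p1) γ j =
      ∏ j ∈ Icc (N - i + 1) N, bwd N (1 / 2) p1 (1 / 2) (1 - p1) γ j := by
  refine prod_nbij' (fun j => N - j) (fun j => N - j) ?_ ?_ ?_ ?_ ?_
  · intro j hj
    simp only [mem_range, mem_Icc] at *
    omega
  · intro j hj
    simp only [mem_range, mem_Icc] at *
    omega
  · intro j hj
    simp only [mem_range] at *
    omega
  · intro j hj
    simp only [mem_Icc] at *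
    omega
  · intro j hj
    exact (bwd_reflect ((mem_range.1 hj).le.trans hi) p1 γ).symm

theorem wt_reflect {N i : ℕ} (hi : i ≤ N) (p1 γ : ℝ) :
    wt N (1 / 2) p1 (1 / 2) (1 - p1) γ (N - i) = wt N (1 / 2) p1 (1 / 2) (1 - p1) γ i := by
  unfold wt
  rw [prod_range_fwd_eq hi, prod_range_fwd_eq (Nat.sub_le N i), Nat.sub_sub_self hi, mul_comm]

theorem gameB_mem_Ioo {p1 p2 p3 : ℝ} (h1 : p1 ∈ Set.Ioo (0 : ℝ) 1) (h2 : p2 ∈ Set.Ioo (0 : ℝ) 1)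
    (h3 : p3 ∈ Set.Ioo (0 : ℝ) 1) (N i : ℕ) : gameB N p1 p2 p3 i ∈ Set.Ioo (0 : ℝ) 1 := by
  unfold gameB
  split_ifs <;> assumption

theorem aProb_mem_Ioo {pA p1 p2 p3 γ : ℝ} (hA : pA ∈ Set.Ioo (0 : ℝ) 1)
    (h1 : p1 ∈ Set.Ioo (0 : ℝ) 1) (h2 : p2 ∈ Set.Ioo (0 : ℝ) 1) (h3 : p3 ∈ Set.Ioo (0 : ℝ) 1)
    (hγ : γ ∈ Set.Icc (0 : ℝ) 1) (N i : ℕ) :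
    aProb N pA p1 p2 p3 γ i ∈ Set.Ioo (0 : ℝ) 1 :=
  convex_Ioo 0 1 hA (gameB_mem_Ioo h1 h2 h3 N i) hγ.1 (sub_nonneg.2 hγ.2) (by ring)

theorem wt_pos {N i : ℕ} (hi : i ≤ N) {pA p1 p2 p3 γ : ℝ}
    (ha : ∀ j, aProb N pA p1 p2 p3 γ j ∈ Set.Ioo (0 : ℝ) 1) : 0 < wt N pA p1 p2 p3 γ i := by
  refine mul_pos (prod_pos fun j hj => ?_) (prod_pos fun j hj => ?_)
  · have hjN : j < N := (mem_range.1 hj).trans_le hi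
    have hN : (0 : ℝ) < N := by exact_mod_cast (Nat.zero_le j).trans_lt hjN
    exact mul_pos (div_pos (sub_pos.2 (by exact_mod_cast hjN)) hN) (ha j).1
  · obtain ⟨hij, hjN⟩ := mem_Icc.1 hj
    have hj0 : 0 < j := by omega
    have hN : 0 < N := by omega
    exact mul_pos (div_pos (by exact_mod_cast hj0) (by exact_mod_cast hN)) (sub_pos.2 (ha j).2)

theorem Znorm_pos {N : ℕ} {pA p1 p2 p3 γ : ℝ}
    (ha : ∀ j, aProb N pA p1 p2 p3 γ j ∈ Set.Ioo (0 : ℝ) 1) : 0 < Znorm N pA p1 p2 p3 γ :=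
  sum_pos (fun _ hi => wt_pos (Nat.lt_succ_iff.1 (mem_range.1 hi)) ha) nonempty_range_add_one

theorem sum_Pst {N : ℕ} {pA p1 p2 p3 γ : ℝ} (hZ : Znorm N pA p1 p2 p3 γ ≠ 0) :
    ∑ i ∈ range (N + 1), Pst N pA p1 p2 p3 γ i = 1 := by
  simp only [Pst, ← sum_div]
  exact div_self hZ

theorem pwin_eq_sum_one_sub (N : ℕ) (p1 γ : ℝ) :
    pwin N (1 / 2) p1 (1 / 2) (1 - p1) γ =
      ∑ i ∈ range (N + 1), (1 - aProb N (1 / 2) p1 (1 / 2) (1 - p1) γ i) *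
        Pst N (1 / 2) p1 (1 / 2) (1 - p1) γ i := by
  rw [pwin, ← sum_range_reflect]
  refine sum_congr rfl fun i hi => ?_
  have hi' : i ≤ N := Nat.lt_succ_iff.1 (mem_range.1 hi)
  rw [Nat.add_sub_cancel, aProb_reflect hi', Pst, wt_reflect hi', Pst]

/-- for `p_A = 1/2` and game-B parameters `{p1, 1/2, 1-p1}` with
`p1 ∈ (0,1)`, the combination `A+B` is fair for every `γ ∈ [0,1]`:
`p_win^{A+B} = 1/2`, i.e. the current `J^{A+B}` vanishes. -/
theorem symmetric_fair (N : ℕ) (hN : 1 ≤ N) (p1 γ : ℝ)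
    (hp1 : p1 ∈ Set.Ioo (0 : ℝ) 1) (hγ : γ ∈ Set.Icc (0 : ℝ) 1) :
    pwin N (1 / 2) p1 (1 / 2) (1 - p1) γ = 1 / 2 ∧
      current N (1 / 2) p1 (1 / 2) (1 - p1) γ = 0 := by
  have half_mem : (1 / 2 : ℝ) ∈ Set.Ioo (0 : ℝ) 1 := by norm_num
  have hp3 : 1 - p1 ∈ Set.Ioo (0 : ℝ) 1 := ⟨sub_pos.2 hp1.2, sub_lt_self 1 hp1.1⟩
  have hsum := sum_Pst (Znorm_pos (aProb_mem_Ioo half_mem hp1 half_mem hp3 hγ N)).ne'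
  have hwin := pwin_eq_sum_one_sub N p1 γ
  simp only [sub_mul, one_mul, sum_sub_distrib, hsum] at hwin
  rw [← pwin] at hwin
  rw [current]
  constructor <;> linarith
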